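/- arXiv:1305.2566 — 5 statements merged into one kernel-verified Lean document; each statement's English description precedes it below -/
import Mathlib

section
/- For every prime n ≥ 3, if G is the Latin-square construction graph, then χ_ℓ(G²) − χ(G²) ≥ n − 1, where χ denotes the chromatic number and χ_ℓ the list chromatic number. -/
/-- Vertex type of the Latin-square construction graph: `Sum.inl (a, c)` encodes the
vertex `v_{a+1, c+1}` of `P`, and `Sum.inr (i, j)` encodes the vertex `w_{i+1, j+1}` of `Q`
(all indices written 0-indexed via `Fin`/`ZMod`). -/
def LSVertex (n : ℕ) : Type := (Fin n × ZMod n) ⊕ (Fin (n - 1) × ZMod n)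

/-- The Latin-square construction graph: the cliques `T_j` consist of the `P`-vertices with a
fixed second coordinate, and `w_{i,j}` is joined to `v_{k, L_i(j,k)}` for every `k`, where
`L_i(j,k) ≡ j + i(k-1) (mod n)` (all written 0-indexed, so the second coordinate of a
neighbor `v_{k, L_i(j,k)}` of `w_{i,j}` is `(j-1) + i·(k-1)` in `ZMod n`). -/
def latinGraph (n : ℕ) : SimpleGraph (LSVertex n) where
  Adj x y :=
    match x, y with
    | Sum.inl (a, c), Sum.inl (b, c') => c = c' ∧ a ≠ b
    | Sum.inl (k, c), Sum.inr (i, j) => c = j + (((i : ℕ) : ZMod n) + 1) * ((k : ℕ) : ZMod n)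
    | Sum.inr (i, j), Sum.inl (k, c) => c = j + (((i : ℕ) : ZMod n) + 1) * ((k : ℕ) : ZMod n)
    | Sum.inr _, Sum.inr _ => False
  symm := by
    refine ⟨?_⟩
    rintro (⟨a, c⟩ | ⟨i, j⟩) (⟨b, c'⟩ | ⟨i', j'⟩) h
    · exact ⟨h.1.symm, h.2.symm⟩
    · exact h
    · exact h
    · exact h
  loopless := by
    refine ⟨?_⟩
    rintro (⟨a, c⟩ | ⟨i, j⟩) h
    · exact h.2 rfl
    · exact h

/-- The set `P` of all `v`-vertices. -/
def Pall (n : ℕ) : Set (LSVertex n) := {x | ∃ a c, x = Sum.inl (a, c)}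

/-- The set `Q` of all `w`-vertices. -/
def Qall (n : ℕ) : Set (LSVertex n) := {x | ∃ i j, x = Sum.inr (i, j)}

/-- The partite set `P_{a+1} = {v_{a+1,1}, …, v_{a+1,n}}`. -/
def Pset (n : ℕ) (a : Fin n) : Set (LSVertex n) := {x | ∃ c, x = Sum.inl (a, c)}

/-- The clique `T_{c+1} = {v_{1,c+1}, …, v_{n,c+1}}`. -/
def Tset (n : ℕ) (c : ZMod n) : Set (LSVertex n) := {x | ∃ a, x = Sum.inl (a, c)}

/-- The partite set `Q_{i+1} = {w_{i+1,1}, …, w_{i+1,n}}`. -/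
def Qset (n : ℕ) (i : Fin (n - 1)) : Set (LSVertex n) := {x | ∃ j, x = Sum.inr (i, j)}

/-- The square of a graph: two distinct vertices are adjacent iff their distance in `G`
is at most 2, i.e. they are adjacent in `G` or have a common neighbor. -/
def graphSquare {V : Type*} (G : SimpleGraph V) : SimpleGraph V where
  Adj x y := x ≠ y ∧ (G.Adj x y ∨ ∃ z, G.Adj x z ∧ G.Adj z y)
  symm := by
    refine ⟨?_⟩
    rintro x y ⟨hxy, h | ⟨z, h1, h2⟩⟩
    · exact ⟨hxy.symm, Or.inl h.symm⟩
    · exact ⟨hxy.symm, Or.inr ⟨z, h2.symm, h1.symm⟩⟩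
  loopless := ⟨fun x h => h.1 rfl⟩

/-- `G` is `k`-choosable: for any assignment of a list of at least `k` colors to each
vertex, there is a proper coloring choosing each vertex's color from its list. -/
def Choosable {V : Type*} (G : SimpleGraph V) (k : ℕ) : Prop :=
  ∀ L : V → Finset ℕ, (∀ v, k ≤ (L v).card) →
    ∃ φ : V → ℕ, (∀ v, φ v ∈ L v) ∧ ∀ ⦃u w⦄, G.Adj u w → φ u ≠ φ w

/-- The list chromatic number: the least `k` such that `G` is `k`-choosable. -/
noncomputable def listChromaticNumber {V : Type*} (G : SimpleGraph V) : ℕ :=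
  sInf {k | Choosable G k}

/-- The chromatic number: the least `k` such that `G` has a proper `k`-coloring. -/
noncomputable def chromNum {V : Type*} (G : SimpleGraph V) : ℕ :=
  sInf {k | G.Colorable k}

/-- The partite class of a vertex. -/
def lsPart (n : ℕ) (x : LSVertex n) : Fin n ⊕ Fin (n - 1) :=
  Sum.map Prod.fst Prod.fst x

/-- The second coordinate of a vertex. -/
def lsSnd (n : ℕ) (x : LSVertex n) : ZMod n :=
  Sum.elim Prod.snd Prod.snd x

/-- The vertex with given class and second coordinate. -/
def lsMk (n : ℕ) (q : Fin n ⊕ Fin (n - 1)) (c : ZMod n) : LSVertex n :=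
  Sum.map (fun a => (a, c)) (fun i => (i, c)) q

theorem cast_fin_inj (n : ℕ) (a b : Fin n) (h : ((a : ℕ) : ZMod n) = ((b : ℕ) : ZMod n)) :
    a = b := by
  rw [ZMod.natCast_eq_natCast_iff] at h
  exact Fin.ext (Nat.ModEq.eq_of_lt_of_lt h a.2 b.2)

theorem slope_ne (n : ℕ) (i : Fin (n - 1)) : ((i : ℕ) : ZMod n) + 1 ≠ 0 := by
  intro h
  have h' : (((i : ℕ) + 1 : ℕ) : ZMod n) = 0 := by push_cast; exact h
  rw [ZMod.natCast_eq_zero_iff] at h'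
  have := Nat.le_of_dvd (by omega) h'
  have := i.2
  omega

theorem slope_inj (n : ℕ) (i j : Fin (n - 1)) (h : ((i : ℕ) : ZMod n) = ((j : ℕ) : ZMod n)) :
    i = j := by
  rw [ZMod.natCast_eq_natCast_iff] at h
  exact Fin.ext (Nat.ModEq.eq_of_lt_of_lt h (by omega) (by omega))

theorem exists_fin (n : ℕ) [NeZero n] (k : ZMod n) : ∃ a : Fin n, ((a : ℕ) : ZMod n) = k :=
  ⟨⟨k.val, ZMod.val_lt k⟩, by simp⟩

theorem exists_slope (n : ℕ) [NeZero n] (s : ZMod n) (hs : s ≠ 0) :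
    ∃ i : Fin (n - 1), ((i : ℕ) : ZMod n) + 1 = s := by
  have h1 : s.val ≠ 0 := by rwa [Ne, ZMod.val_eq_zero]
  have h2 := ZMod.val_lt s
  refine ⟨⟨s.val - 1, by omega⟩, ?_⟩
  have h3 : ((s.val - 1 + 1 : ℕ) : ZMod n) = s := by
    rw [Nat.sub_add_cancel (by omega)]; simp
  push_cast at h3
  exact h3

theorem sq_adj_of_part_ne (n : ℕ) [Fact n.Prime] (x y : LSVertex n)
    (h : lsPart n x ≠ lsPart n y) : (graphSquare (latinGraph n)).Adj x y := by
  have key : ∀ (k : Fin n) (c : ZMod n) (i : Fin (n - 1)) (j : ZMod n),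
      ∃ z, (latinGraph n).Adj (Sum.inl (k, c)) z ∧ (latinGraph n).Adj z (Sum.inr (i, j)) ∨
        (latinGraph n).Adj (Sum.inl (k, c)) (Sum.inr (i, j)) := by
    intro k c i j
    obtain ⟨a, ha⟩ := exists_fin n ((c - j) / (((i : ℕ) : ZMod n) + 1))
    have hi := slope_ne n i
    have e : c = j + (((i : ℕ) : ZMod n) + 1) * ((a : ℕ) : ZMod n) := by
      rw [ha]; field_simp; ring
    refine ⟨Sum.inl (a, c), ?_⟩
    by_cases hk : k = a
    · subst hk; exact Or.inr e
    · exact Or.inl ⟨⟨rfl, hk⟩, e⟩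
  have hxy : x ≠ y := fun e => h (by rw [e])
  rcases x with ⟨a, c⟩ | ⟨i, j⟩ <;> rcases y with ⟨b, c'⟩ | ⟨i', j'⟩
  · have hab : a ≠ b := fun e => h (by rw [e]; rfl)
    refine ⟨hxy, ?_⟩
    by_cases hc : c = c'
    · exact Or.inl ⟨hc, hab⟩
    · right
      have hd : ((a : ℕ) : ZMod n) - ((b : ℕ) : ZMod n) ≠ 0 :=
        fun e => hab (cast_fin_inj n a b (sub_eq_zero.mp e))
      obtain ⟨i, hi⟩ := exists_slope n ((c - c') / (((a : ℕ) : ZMod n) - ((b : ℕ) : ZMod n)))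
        (div_ne_zero (sub_ne_zero.mpr hc) hd)
      refine ⟨Sum.inr (i, c - (((i : ℕ) : ZMod n) + 1) * ((a : ℕ) : ZMod n)), ?_, ?_⟩
      · change c = _
        ring
      · change c' = _
        rw [hi]
        field_simp
        ring
  · obtain ⟨z, hz | hz⟩ := key a c i' j'
    · exact ⟨hxy, Or.inr ⟨z, hz⟩⟩
    · exact ⟨hxy, Or.inl hz⟩
  · obtain ⟨z, hz | hz⟩ := key b c' i j
    · exact ⟨hxy, Or.inr ⟨z, hz.2.symm, hz.1.symm⟩⟩
    · exact ⟨hxy, Or.inl hz.symm⟩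
  · have hii : i ≠ i' := fun e => h (by rw [e]; rfl)
    have hd : ((i : ℕ) : ZMod n) - ((i' : ℕ) : ZMod n) ≠ 0 :=
      fun e => hii (slope_inj n i i' (sub_eq_zero.mp e))
    obtain ⟨a, ha⟩ := exists_fin n ((j' - j) / (((i : ℕ) : ZMod n) - ((i' : ℕ) : ZMod n)))
    refine ⟨hxy, Or.inr ⟨Sum.inl (a, j + (((i : ℕ) : ZMod n) + 1) * ((a : ℕ) : ZMod n)),
      rfl, ?_⟩⟩
    change j + _ = j' + _
    rw [ha]
    field_simp
    ring

theorem part_ne_of_sq_adj (n : ℕ) [Fact n.Prime] (x y : LSVertex n)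
    (h : (graphSquare (latinGraph n)).Adj x y) : lsPart n x ≠ lsPart n y := by
  intro hp
  obtain ⟨hxy, h⟩ := h
  rcases x with ⟨a, c⟩ | ⟨i, j⟩ <;> rcases y with ⟨b, c'⟩ | ⟨i', j'⟩
  · have hab : a = b := Sum.inl_injective hp
    subst hab
    rcases h with h | ⟨⟨d, e⟩ | ⟨i, j⟩, h1, h2⟩
    · exact h.2 rfl
    · exact hxy (by rw [show c = c' from h1.1.trans h2.1])
    · have h1' : c = j + (((i : ℕ) : ZMod n) + 1) * ((a : ℕ) : ZMod n) := h1
      have h2' : c' = j + (((i : ℕ) : ZMod n) + 1) * ((a : ℕ) : ZMod n) := h2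
      exact hxy (by rw [h1', h2'])
  · exact absurd hp (by simp [lsPart])
  · exact absurd hp (by simp [lsPart])
  · have hab : i = i' := Sum.inr_injective hp
    subst hab
    rcases h with h | ⟨⟨a, c⟩ | ⟨i', j''⟩, h1, h2⟩
    · exact h
    · have h1' : c = j + (((i : ℕ) : ZMod n) + 1) * ((a : ℕ) : ZMod n) := h1
      have h2' : c = j' + (((i : ℕ) : ZMod n) + 1) * ((a : ℕ) : ZMod n) := h2
      exact hxy (by rw [add_right_cancel (h1'.symm.trans h2')])
    · exact h1

theorem chromNum_le (n : ℕ) [Fact n.Prime] :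
    chromNum (graphSquare (latinGraph n)) ≤ n + (n - 1) := by
  apply Nat.sInf_le
  have C : (graphSquare (latinGraph n)).Coloring (Fin n ⊕ Fin (n - 1)) :=
    SimpleGraph.Coloring.mk (lsPart n) (fun {x y} h => part_ne_of_sq_adj n x y h)
  have := C.colorable
  simpa using this

theorem exists_choosable {V : Type*} [Fintype V] (G : SimpleGraph V) :
    Choosable G (Fintype.card V) := by
  classical
  intro L hL
  obtain ⟨f, hf, hm⟩ := (Finset.all_card_le_biUnion_card_iff_exists_injective L).mp (by
    intro s
    rcases s.eq_empty_or_nonempty with rfl | ⟨v, hv⟩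
    · simp
    · calc s.card ≤ Fintype.card V := s.card_le_univ
        _ ≤ (L v).card := hL v
        _ ≤ _ := Finset.card_le_card (Finset.subset_biUnion_of_mem L hv))
  exact ⟨f, hm, fun u w h e => h.ne (hf e)⟩

open Classical in
theorem list_card (n : ℕ) [NeZero n] (c : ZMod n) :
    3 * n - 3 ≤ ((Finset.range (3 * n)).filter (fun x : ℕ => (x : ZMod n) ≠ c)).card := by
  have h1 := Finset.card_filter_add_card_filter_not (s := Finset.range (3 * n))
    (fun x : ℕ => (x : ZMod n) = c)
  have h2 : ((Finset.range (3 * n)).filter (fun x : ℕ => (x : ZMod n) = c)) ⊆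
      (Finset.range 3).image (fun t => c.val + n * t) := by
    intro x hx
    simp only [Finset.mem_filter, Finset.mem_range] at hx
    simp only [Finset.mem_image, Finset.mem_range]
    refine ⟨x / n, ?_, ?_⟩
    · exact Nat.div_lt_of_lt_mul (by linarith [hx.1])
    · rw [← hx.2, ZMod.val_natCast]
      exact Nat.mod_add_div x n
  have h3 := (Finset.card_le_card h2).trans Finset.card_image_le
  simp only [Finset.card_range] at h1 h3
  simp only [ne_eq]
  omega

theorem not_choosable (n : ℕ) [Fact n.Prime] (hn : 3 ≤ n) (k : ℕ) (hk : k ≤ 3 * n - 3) :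
    ¬ Choosable (graphSquare (latinGraph n)) k := by
  classical
  intro H
  obtain ⟨φ, hφ, hadj⟩ := H
    (fun v => (Finset.range (3 * n)).filter (fun x : ℕ => (x : ZMod n) ≠ lsSnd n v))
    (fun v => hk.trans (by convert list_card n (lsSnd n v)))
  simp only [Finset.mem_filter, Finset.mem_range] at hφ
  have hsnd : ∀ q c, lsSnd n (lsMk n q c) = c := by
    rintro (a | i) c <;> rfl
  have hpart : ∀ q c, lsPart n (lsMk n q c) = q := by
    rintro (a | i) c <;> rfl
  let g : (Fin n ⊕ Fin (n - 1)) × Bool → LSVertex n := fun p =>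
    if p.2 then lsMk n p.1 0 else lsMk n p.1 ((φ (lsMk n p.1 0) : ℕ) : ZMod n)
  have hg : ∀ p, lsPart n (g p) = p.1 := by
    rintro ⟨q, b⟩
    cases b <;> simp [g, hpart]
  have hne : ∀ q, φ (g (q, true)) ≠ φ (g (q, false)) := by
    intro q e
    have := (hφ (g (q, false))).2
    rw [← e] at this
    simp [g, hsnd] at this
  let f : (Fin n ⊕ Fin (n - 1)) × Bool → Fin (3 * n) := fun p => ⟨φ (g p), (hφ (g p)).1⟩
  have hf : Function.Injective f := by
    rintro ⟨q, b⟩ ⟨q', b'⟩ e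
    have e' : φ (g (q, b)) = φ (g (q', b')) := congrArg Fin.val e
    have hq : q = q' := by
      by_contra hq
      exact hadj (sq_adj_of_part_ne n (g (q, b)) (g (q', b')) (by rw [hg, hg]; exact hq)) e'
    subst hq
    cases b <;> cases b'
    · rfl
    · exact absurd e'.symm (hne q)
    · exact absurd e' (hne q)
    · rfl
  have := Fintype.card_le_of_injective f hf
  simp at this
  omega

/-- For every prime `n ≥ 3`, the Latin-square construction graph `G` satisfies
`χ_ℓ(G²) - χ(G²) ≥ n - 1`. -/
theorem listChromatic_sub_chromatic_ge (n : ℕ) (hp : n.Prime) (hn : 3 ≤ n) :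
    (n : ℤ) - 1 ≤ (listChromaticNumber (graphSquare (latinGraph n)) : ℤ) -
      (chromNum (graphSquare (latinGraph n)) : ℤ) := by
  haveI : Fact n.Prime := ⟨hp⟩
  have h1 := chromNum_le n
  have h2 : 3 * n - 2 ≤ listChromaticNumber (graphSquare (latinGraph n)) := by
    haveI : Fintype (LSVertex n) :=
      inferInstanceAs (Fintype ((Fin n × ZMod n) ⊕ (Fin (n - 1) × ZMod n)))
    have hmem : Choosable (graphSquare (latinGraph n))
        (listChromaticNumber (graphSquare (latinGraph n))) :=
      Nat.sInf_mem (s := {k | Choosable (graphSquare (latinGraph n)) k}) ⟨_, exists_choosable _⟩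
    by_contra hlt
    exact not_choosable n hn _ (by omega) hmem
  omega
end

section
/- In the Latin-square construction graph G, for every vertex x ∈ Q and every k ∈ [n], the neighborhood of x in G meets the clique T_k in exactly one vertex: |N_G(x) ∩ T_k| = 1. -/
/-- In the Latin-square construction graph, for every vertex `x ∈ Q` and every `k ∈ [n]`,
`|N_G(x) ∩ T_k| = 1`. -/
theorem neighborSet_inter_Tset_ncard (n : ℕ) (hp : n.Prime) (hn : 3 ≤ n)
    (x : LSVertex n) (hx : x ∈ Qall n) (k : ZMod n) :
    ((latinGraph n).neighborSet x ∩ Tset n k).ncard = 1 := by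
  haveI : Fact n.Prime := ⟨hp⟩
  obtain ⟨i, j, rfl⟩ := hx
  have hi : (((i : ℕ) : ZMod n) + 1) ≠ 0 := by
    intro h
    have h2 : (((i : ℕ) + 1 : ℕ) : ZMod n) = 0 := by push_cast; exact h
    rw [ZMod.natCast_eq_zero_iff] at h2
    have h3 := Nat.le_of_dvd (Nat.succ_pos _) h2
    have h4 := i.isLt
    omega
  rw [Set.ncard_eq_one]
  refine ⟨Sum.inl (⟨((k - j) / (((i : ℕ) : ZMod n) + 1)).val, ZMod.val_lt _⟩, k), ?_⟩
  apply Set.eq_singleton_iff_unique_mem.mpr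
  constructor
  · refine ⟨?_, ⟨_, rfl⟩⟩
    change k = j + (((i : ℕ) : ZMod n) + 1) *
      ((((k - j) / (((i : ℕ) : ZMod n) + 1)).val : ℕ) : ZMod n)
    rw [ZMod.natCast_zmod_val, mul_div_cancel₀ _ hi]
    ring
  · rintro y ⟨hy, a, rfl⟩
    have hy' : k = j + (((i : ℕ) : ZMod n) + 1) * ((a : ℕ) : ZMod n) := hy
    have ha : a = ⟨((k - j) / (((i : ℕ) : ZMod n) + 1)).val, ZMod.val_lt _⟩ := by
      apply Fin.ext
      have h5 : (k - j) / (((i : ℕ) : ZMod n) + 1) = ((a : ℕ) : ZMod n) := by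
        rw [div_eq_iff hi, sub_eq_iff_eq_add]
        rw [hy']
        ring
      change (a : ℕ) = ((k - j) / (((i : ℕ) : ZMod n) + 1)).val
      rw [h5, ZMod.val_natCast_of_lt a.isLt]
    exact congrArg (fun b => (Sum.inl (b, k) : LSVertex n)) ha
end

section
/- In the Latin-square construction graph G, any two distinct vertices x, y ∈ Q have at most one common neighbor: |N_G(x) ∩ N_G(y)| ≤ 1; moreover, if x and y both lie in the same set Q_i for some i ∈ [n−1], then they have no common neighbor: |N_G(x) ∩ N_G(y)| = 0. -/
/-- In the Latin-square construction graph, any two distinct vertices `x, y ∈ Q` have at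
most one common neighbor; moreover, if they lie in the same partite set `Q_i`, then they
have no common neighbor. -/
theorem common_neighbors_of_Q (n : ℕ) (hp : n.Prime) (hn : 3 ≤ n)
    (x y : LSVertex n) (hx : x ∈ Qall n) (hy : y ∈ Qall n) (hxy : x ≠ y) :
    ((latinGraph n).neighborSet x ∩ (latinGraph n).neighborSet y).ncard ≤ 1 ∧
    (∀ i : Fin (n - 1), x ∈ Qset n i → y ∈ Qset n i →
      ((latinGraph n).neighborSet x ∩ (latinGraph n).neighborSet y).ncard = 0) := by
  haveI : Fact n.Prime := ⟨hp⟩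
  have castinj : ∀ a b : ℕ, a < n → b < n → (a : ZMod n) = (b : ZMod n) → a = b := by
    intro a b ha hb h
    have h2 := (ZMod.natCast_eq_natCast_iff' a b n).1 h
    rwa [Nat.mod_eq_of_lt ha, Nat.mod_eq_of_lt hb] at h2
  have hempty : ∀ i : Fin (n - 1), x ∈ Qset n i → y ∈ Qset n i →
      (latinGraph n).neighborSet x ∩ (latinGraph n).neighborSet y = ∅ := by
    rintro i ⟨j, rfl⟩ ⟨j', rfl⟩
    rw [Set.eq_empty_iff_forall_notMem]
    rintro (⟨k, c⟩ | ⟨k, c⟩) ⟨h1, h2⟩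
    · change c = j + (((i : ℕ) : ZMod n) + 1) * ((k : ℕ) : ZMod n) at h1
      change c = j' + (((i : ℕ) : ZMod n) + 1) * ((k : ℕ) : ZMod n) at h2
      have hj : j = j' := add_right_cancel (h1.symm.trans h2)
      exact hxy (by rw [hj])
    · exact h1
  refine ⟨?_, fun i h1 h2 => by rw [hempty i h1 h2, Set.ncard_empty]⟩
  have hsub : ((latinGraph n).neighborSet x ∩ (latinGraph n).neighborSet y).Subsingleton := by
    obtain ⟨i, j, rfl⟩ := hx
    obtain ⟨i', j', rfl⟩ := hy
    by_cases hi : i = i'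
    · subst hi
      rw [hempty i ⟨j, rfl⟩ ⟨j', rfl⟩]
      exact Set.subsingleton_empty
    have hd : ((i : ℕ) : ZMod n) - ((i' : ℕ) : ZMod n) ≠ 0 := fun h =>
      hi (Fin.ext (castinj _ _ (by omega) (by omega) (sub_eq_zero.1 h)))
    rintro (⟨k, c⟩ | ⟨k, c⟩) ⟨h1, h2⟩ (⟨l, d⟩ | ⟨l, d⟩) ⟨h3, h4⟩
    · change c = j + (((i : ℕ) : ZMod n) + 1) * ((k : ℕ) : ZMod n) at h1
      change c = j' + (((i' : ℕ) : ZMod n) + 1) * ((k : ℕ) : ZMod n) at h2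
      change d = j + (((i : ℕ) : ZMod n) + 1) * ((l : ℕ) : ZMod n) at h3
      change d = j' + (((i' : ℕ) : ZMod n) + 1) * ((l : ℕ) : ZMod n) at h4
      have hkl : (((i : ℕ) : ZMod n) - ((i' : ℕ) : ZMod n)) *
          (((k : ℕ) : ZMod n) - ((l : ℕ) : ZMod n)) = 0 := by
        linear_combination h2 - h1 - h4 + h3
      have hk : k = l := Fin.ext (castinj _ _ k.2 l.2
        (sub_eq_zero.1 ((mul_eq_zero.1 hkl).resolve_left hd)))
      subst hk
      rw [h1, h3]
    · exact h3.elim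
    · exact h1.elim
    · exact h1.elim
  rcases hsub.eq_empty_or_singleton with h | ⟨z, h⟩ <;> rw [h] <;> simp
end

section
/- In the Latin-square construction graph G, for each i ∈ [n] the set P_i is an independent set of G², and for each i ∈ [n−1] the set Q_i is an independent set of G². -/
/-- In the Latin-square construction graph `G`, each `P_i` (`i ∈ [n]`) and each `Q_i`
(`i ∈ [n-1]`) is an independent set of `G²`. -/
theorem Pset_Qset_indep_in_square (n : ℕ) (hp : n.Prime) (hn : 3 ≤ n) :
    (∀ a : Fin n, ∀ x ∈ Pset n a, ∀ y ∈ Pset n a,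
      ¬ (graphSquare (latinGraph n)).Adj x y) ∧
    (∀ i : Fin (n - 1), ∀ x ∈ Qset n i, ∀ y ∈ Qset n i,
      ¬ (graphSquare (latinGraph n)).Adj x y) := by
  constructor
  · rintro a _ ⟨c, rfl⟩ _ ⟨c', rfl⟩ ⟨hne, h | ⟨⟨b, d⟩ | ⟨i, j⟩, h1, h2⟩⟩
    · exact h.2 rfl
    · have e : c = c' := h1.1.trans h2.1
      exact hne (by rw [e])
    · have e : c = c' := Eq.trans h1 (Eq.symm h2)
      exact hne (by rw [e])
  · rintro i _ ⟨j, rfl⟩ _ ⟨j', rfl⟩ ⟨hne, h | ⟨⟨b, d⟩ | ⟨i', k⟩, h1, h2⟩⟩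
    · exact h
    · have e : j = j' := add_right_cancel (Eq.trans (Eq.symm h1) h2)
      exact hne (by rw [e])
    · exact h1
end

section
/- In the Latin-square construction graph G, every vertex x ∈ P is adjacent in G² to every vertex y ∈ Q; that is, the distance in G between any vertex of P and any vertex of Q is at most 2. -/
/-- In the Latin-square construction graph `G`, every vertex of `P` is adjacent in `G²`
to every vertex of `Q`. -/
theorem P_adjacent_Q_in_square (n : ℕ) (hp : n.Prime) (hn : 3 ≤ n)
    (x : LSVertex n) (hx : x ∈ Pall n) (y : LSVertex n) (hy : y ∈ Qall n) :
    (graphSquare (latinGraph n)).Adj x y := by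
  obtain ⟨a, c, rfl⟩ := hx
  obtain ⟨i, j, rfl⟩ := hy
  have : Fact n.Prime := ⟨hp⟩
  have hi : (((i : ℕ) : ZMod n) + 1) ≠ 0 := by
    intro h
    have h' : (((i : ℕ) + 1 : ℕ) : ZMod n) = 0 := by
      push_cast
      exact h
    rw [ZMod.natCast_eq_zero_iff] at h'
    have := Nat.le_of_dvd (Nat.succ_pos _) h'
    have := i.isLt
    omega
  refine ⟨Sum.inl_ne_inr, ?_⟩
  let t : ZMod n := (c - j) / (((i : ℕ) : ZMod n) + 1)
  let k : Fin n := ⟨t.val, ZMod.val_lt t⟩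
  have hk : c = j + (((i : ℕ) : ZMod n) + 1) * ((k : ℕ) : ZMod n) := by
    have : ((k : ℕ) : ZMod n) = t := ZMod.natCast_zmod_val t
    rw [this, mul_div_cancel₀ _ hi]
    ring
  by_cases hak : a = k
  · left
    rw [hak]
    exact hk
  · right
    exact ⟨Sum.inl (k, c), ⟨rfl, hak⟩, hk⟩
end
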